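/- arXiv:2111.09233 — 6 statements merged into one kernel-verified Lean document; each statement's English description precedes it below -/
import Mathlib

section
/- Let p be an odd natural number with p ≥ 3, let n ≥ 2, and set N = n·(p−1)+1. For each a ∈ {0,…,n−1}, let c_a be the step p-cycle starting at a·(p−1) in the symmetric group of Fin N. Then the subgroup of Equiv.Perm (Fin N) generated by the set {c_0, c_1, …, c_{n−1}} is exactly the alternating group on Fin N. -/
/-- The step `p`-cycle starting at `a` in `Equiv.Perm (Fin N)`: the cyclic permutation
`a ↦ a+1 ↦ ⋯ ↦ a+p-1 ↦ a`, fixing all other points. -/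
def stepCycle (N a p : ℕ) (h : a + p ≤ N) : Equiv.Perm (Fin N) :=
  ((List.finRange p).map (fun i => (⟨a + i.val, by have := i.isLt; omega⟩ : Fin N))).formPerm

theorem stepCycle_bound {p n : ℕ} (hp : 1 ≤ p) (a : Fin n) :
    a.val * (p - 1) + p ≤ n * (p - 1) + 1 := by
  obtain ⟨m, rfl⟩ : ∃ m, n = m + 1 := ⟨n - 1, by have := a.pos; omega⟩
  have h1 : a.val ≤ m := by have := a.isLt; omega
  calc a.val * (p - 1) + p ≤ m * (p - 1) + p := by gcongr
    _ = m * (p - 1) + ((p - 1) + 1) := by rw [Nat.sub_add_cancel hp]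
    _ = (m + 1) * (p - 1) + 1 := by ring

open Equiv.Perm MulAction Pointwise

section StepCycle

variable {N a p : ℕ}

/-- The list defining `stepCycle` has no repeated entries. -/
theorem nodup_stepCycle_list (h : a + p ≤ N) :
    ((List.finRange p).map
      (fun i => (⟨a + i.val, by have := i.isLt; omega⟩ : Fin N))).Nodup := by
  refine (List.nodup_finRange p).map fun i j hij => ?_
  simpa [Fin.ext_iff] using hij

theorem stepCycle_apply_of_lt (h : a + p ≤ N) {x : Fin N} (hax : a ≤ x) (hxp : x.val + 1 < a + p) :
    (stepCycle N a p h x : ℕ) = x + 1 := by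
  have key := List.formPerm_apply_lt_getElem _ (nodup_stepCycle_list h) (x - a)
    (by simp only [List.length_map, List.length_finRange]; omega)
  simp only [List.getElem_map, List.getElem_finRange, Fin.val_cast] at key
  have hx : (⟨a + (x - a), by omega⟩ : Fin N) = x := Fin.ext (by simp only; omega)
  rw [hx] at key
  rw [stepCycle, key]
  simp only
  omega

theorem stepCycle_apply_last (h : a + p ≤ N) (hp : 0 < p) {x : Fin N} (hx : x.val + 1 = a + p) :
    (stepCycle N a p h x : ℕ) = a := by
  have key := List.formPerm_apply_getElem _ (nodup_stepCycle_list h) (x - a)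
    (by simp only [List.length_map, List.length_finRange]; omega)
  simp only [List.getElem_map, List.getElem_finRange, Fin.val_cast, List.length_map,
    List.length_finRange] at key
  have hx' : (⟨a + (x - a), by omega⟩ : Fin N) = x := Fin.ext (by simp only; omega)
  rw [hx'] at key
  rw [stepCycle, key]
  simp [show (x : ℕ) - a + 1 = p by omega]

theorem stepCycle_apply_of_notMem (h : a + p ≤ N) {x : Fin N} (hx : x.val < a ∨ a + p ≤ x) :
    stepCycle N a p h x = x := by
  refine List.formPerm_apply_of_notMem fun hmem => ?_
  obtain ⟨i, -, rfl⟩ := List.mem_map.mp hmem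
  simp only at hx
  omega

theorem stepCycle_mem_alternatingGroup (h : a + p ≤ N) (hodd : Odd p) :
    stepCycle N a p h ∈ alternatingGroup (Fin N) := by
  have hpow : stepCycle N a p h ^ p = 1 := by
    simpa [stepCycle] using List.formPerm_pow_length_eq_one_of_nodup _ (nodup_stepCycle_list h)
  rw [mem_alternatingGroup]
  have hsign := congrArg sign hpow
  rw [map_pow, map_one] at hsign
  rcases Int.units_eq_one_or (sign (stepCycle N a p h)) with h1 | h1
  · exact h1
  · rw [h1, hodd.neg_one_pow] at hsign
    exact absurd hsign (by decide)

end StepCycle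

theorem apply_ne_apply_of_inter_support {α : Type*} {σ τ : Equiv.Perm α} {x : α}
    (hσ : σ x ≠ x) (hτ : τ x ≠ x) (h : ∀ y, y ≠ x → σ y = y ∨ τ y = y) : τ x ≠ σ x := by
  intro he
  rcases h (σ x) hσ with h1 | h1
  · exact hσ (σ.injective h1)
  · exact hτ (τ.injective (by rw [← he] at h1; exact h1))

/-- The commutator of two permutations whose supports meet in exactly one point `x` is the
three-cycle `x ↦ σ x ↦ τ x ↦ x`. -/
theorem commutator_eq_swap_mul_swap {α : Type*} [DecidableEq α] {σ τ : Equiv.Perm α} {x : α}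
    (hσ : σ x ≠ x) (hτ : τ x ≠ x) (h : ∀ y, y ≠ x → σ y = y ∨ τ y = y) :
    σ * τ * σ⁻¹ * τ⁻¹ = Equiv.swap x (τ x) * Equiv.swap x (σ x) := by
  suffices hst : σ * τ = Equiv.swap x (τ x) * Equiv.swap x (σ x) * (τ * σ) by
    rw [hst]; group
  have hne := apply_ne_apply_of_inter_support hσ hτ h
  have hστ : σ (τ x) = τ x := (h _ hτ).resolve_right fun h1 => hτ (τ.injective h1)
  have hτσ : τ (σ x) = σ x := (h _ hσ).resolve_left fun h1 => hσ (σ.injective h1)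
  ext y
  simp only [Equiv.Perm.mul_apply]
  by_cases hy : y = x
  · rw [hy, hστ, hτσ, Equiv.swap_apply_right, Equiv.swap_apply_left]
  by_cases hτy : τ y = x
  · have hσy : σ y = y := (h y hy).resolve_right fun h1 => hy (h1.symm.trans hτy)
    rw [hσy, hτy, Equiv.swap_apply_left, Equiv.swap_apply_of_ne_of_ne hσ hne.symm]
  by_cases hσy : σ y = x
  · have hτy' : τ y = y := (h y hy).resolve_left fun h1 => hy (h1.symm.trans hσy)
    rw [hτy', hσy, Equiv.swap_apply_of_ne_of_ne hτ hne, Equiv.swap_apply_right]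
  have hcomm : σ (τ y) = τ (σ y) := by
    rcases h y hy with h1 | h1
    · rw [h1]
      rcases h (τ y) hτy with h2 | h2
      · exact h2
      · rw [τ.injective h2, h1]
    · rw [h1]
      rcases h (σ y) hσy with h2 | h2
      · rw [σ.injective h2, h1]
      · exact h2.symm
  have h1 : τ (σ y) ≠ x := by
    rcases h y hy with h1 | h1
    · rwa [h1]
    · rwa [← hcomm, h1]
  have h2 : τ (σ y) ≠ τ x := fun h2 => hσy (τ.injective h2)
  have h3 : τ (σ y) ≠ σ x := fun h3 => hτy (σ.injective (hcomm.trans h3))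
  rw [hcomm, Equiv.swap_apply_of_ne_of_ne h1 h3, Equiv.swap_apply_of_ne_of_ne h1 h2]

/-- A block with at least two points is stable under every three-cycle of the group. -/
theorem MulAction.IsBlock.apply_mem_of_isThreeCycle {α : Type*} [Fintype α] [DecidableEq α]
    {H : Subgroup (Equiv.Perm α)} {B : Set α} (hB : IsBlock H B) (hnt : B.Nontrivial)
    {t : Equiv.Perm α} (htH : t ∈ H) (ht : t.IsThreeCycle) {u : α} (hu : u ∈ B) : t u ∈ B := by
  by_cases htu : t u = u
  · rwa [htu]
  have key : ∀ b ∈ B, t b ∈ B → t u ∈ B := fun b hb htb => by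
    rw [← hB.smul_eq_of_mem (g := ⟨t, htH⟩) hb htb]
    exact Set.smul_mem_smul_set hu
  obtain ⟨b, hb, hbu⟩ := hnt.exists_ne u
  by_cases htb : t b = b
  · exact key b hb (by rwa [htb])
  obtain ⟨i, hi, rfl⟩ := (ht.isCycle.sameCycle htu htb).exists_pow_eq'
  rw [ht.orderOf] at hi
  interval_cases i
  · simp at hbu
  · simpa using hb
  · refine key _ hb ?_
    have h3 : t ^ 3 = 1 := ht.orderOf ▸ pow_orderOf_eq_one t
    rw [← Equiv.Perm.mul_apply, ← pow_succ', h3]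
    simpa using hu


theorem Set.Nontrivial.smul_set_of_group {G α : Type*} [Group G] [MulAction G α] {B : Set α}
    (hB : B.Nontrivial) (g : G) : (g • B).Nontrivial :=
  hB.image (MulAction.injective g)

/-- A subgroup containing the overlapping step cycles contains the alternating group. -/
theorem alternatingGroup_le_of_stepCycle_mem {q n : ℕ} (hq : 2 ≤ q) (hn : 2 ≤ n)
    {H : Subgroup (Equiv.Perm (Fin (n * q + 1)))}
    (hH : ∀ (a : ℕ) (ha : a * q + (q + 1) ≤ n * q + 1), a < n →
      stepCycle (n * q + 1) (a * q) (q + 1) ha ∈ H) :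
    alternatingGroup (Fin (n * q + 1)) ≤ H := by
  have bound : ∀ a, a < n → a * q + (q + 1) ≤ n * q + 1 := fun a ha => by
    have := Nat.mul_le_mul_right q (show a + 1 ≤ n from ha)
    rw [Nat.succ_mul] at this
    omega
  -- Consecutive cycles meet in one point, which produces a three-cycle through that point.
  have threeCycle : ∀ a, a + 1 < n → ∃ t ∈ H, t.IsThreeCycle ∧
      ∀ x : Fin (n * q + 1), x.val = (a + 1) * q →
        (t x).val = a * q ∧ (t (t x)).val = (a + 1) * q + 1 := by
    intro a ha
    have hσb := bound a (by omega)
    have hτb := bound (a + 1) ha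
    have hmul : (a + 1) * q = a * q + q := Nat.succ_mul a q
    obtain ⟨x, hx⟩ : ∃ x : Fin (n * q + 1), x.val = (a + 1) * q := ⟨⟨_, by omega⟩, rfl⟩
    set σ := stepCycle _ _ _ hσb with hσ
    set τ := stepCycle _ _ _ hτb with hτ
    have hσx : (σ x).val = a * q := stepCycle_apply_last hσb (by omega) (by omega)
    have hτx : (τ x).val = (a + 1) * q + 1 := by
      rw [← hx]
      exact stepCycle_apply_of_lt hτb (by omega) (by omega)
    have hσne : σ x ≠ x := fun h => by rw [h] at hσx; omega
    have hτne : τ x ≠ x := fun h => by rw [h] at hτx; omega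
    have hdisj : ∀ y, y ≠ x → σ y = y ∨ τ y = y := fun y hy => by
      have hy' : y.val ≠ x.val := fun h => hy (Fin.ext h)
      rcases lt_or_gt_of_ne hy' with h | h
      · exact Or.inr (stepCycle_apply_of_notMem hτb (by omega))
      · exact Or.inl (stepCycle_apply_of_notMem hσb (by omega))
    have hne := apply_ne_apply_of_inter_support hσne hτne hdisj
    have hσH : σ ∈ H := hH a hσb (by omega)
    have hτH : τ ∈ H := hH (a + 1) hτb ha
    refine ⟨Equiv.swap x (τ x) * Equiv.swap x (σ x), ?_,
      isThreeCycle_swap_mul_swap_same hτne.symm hσne.symm hne, ?_⟩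
    · rw [← commutator_eq_swap_mul_swap hσne hτne hdisj]
      exact H.mul_mem (H.mul_mem (H.mul_mem hσH hτH) (H.inv_mem hσH)) (H.inv_mem hτH)
    · intro y hy
      obtain rfl : y = x := Fin.ext (hy.trans hx.symm)
      have h1 : (Equiv.swap y (τ y) * Equiv.swap y (σ y)) y = σ y := by
        rw [Equiv.Perm.mul_apply, Equiv.swap_apply_left,
          Equiv.swap_apply_of_ne_of_ne hσne hne.symm]
      rw [h1, Equiv.Perm.mul_apply, Equiv.swap_apply_right, Equiv.swap_apply_left]
      exact ⟨hσx, hτx⟩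
  -- A nontrivial block is closed under passing to the next point.
  have next_mem : ∀ j, j < q → ∀ a, a < n → ∀ B : Set (Fin (n * q + 1)), IsBlock H B →
      B.Nontrivial → ∀ x ∈ B, ∀ y, x.val = a * q + j → y.val = x.val + 1 → y ∈ B := by
    have shift : ∀ (B : Set (Fin (n * q + 1))) (g : H), IsBlock H B → B.Nontrivial →
        IsBlock H (g⁻¹ • B) ∧ (g⁻¹ • B).Nontrivial :=
      fun B g hB hnt => ⟨hB.translate _, hnt.smul_set_of_group _⟩
    intro j
    induction j with
    | zero =>
      intro _ a ha B hB hnt x hxB y hx hy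
      rcases a with _ | a
      · obtain ⟨t, htH, ht, htx⟩ := threeCycle 0 (by omega)
        have hb := bound 0 (by omega)
        let g : H := ⟨stepCycle _ _ _ hb, hH 0 hb (by omega)⟩
        obtain ⟨z, hz⟩ : ∃ z : Fin (n * q + 1), z.val = (0 + 1) * q := ⟨⟨_, by omega⟩, rfl⟩
        have hgz : g • z = x := Fin.ext (by
          refine (stepCycle_apply_last hb (by omega) (by omega)).trans ?_
          omega)
        have hgx : g • x = y := Fin.ext (by
          refine (stepCycle_apply_of_lt hb (by omega) (by omega)).trans ?_
          omega)
        obtain ⟨hB', hnt'⟩ := shift B g hB hnt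
        have hzB : z ∈ g⁻¹ • B := by rwa [Set.mem_inv_smul_set_iff, hgz]
        have htz : t z = x := Fin.ext (by rw [(htx z hz).1, hx, add_zero])
        have hxB' := hB'.apply_mem_of_isThreeCycle hnt' htH ht hzB
        rwa [htz, Set.mem_inv_smul_set_iff, hgx] at hxB'
      · obtain ⟨t, htH, ht, htx⟩ := threeCycle a ha
        have hty : t (t x) = y := Fin.ext (by rw [(htx x (by omega)).2, hy, hx])
        rw [← hty]
        exact hB.apply_mem_of_isThreeCycle hnt htH ht
          (hB.apply_mem_of_isThreeCycle hnt htH ht hxB)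
    | succ j ih =>
      intro hj a ha B hB hnt x hxB y hx hy
      have hb := bound a ha
      let g : H := ⟨stepCycle _ _ _ hb, hH a hb ha⟩
      obtain ⟨z, hz⟩ : ∃ z : Fin (n * q + 1), z.val = a * q + j := ⟨⟨_, by omega⟩, rfl⟩
      have hgz : g • z = x := Fin.ext (by
        refine (stepCycle_apply_of_lt hb (by omega) (by omega)).trans ?_
        omega)
      have hgx : g • x = y := Fin.ext (by
        refine (stepCycle_apply_of_lt hb (by omega) (by omega)).trans ?_
        omega)
      obtain ⟨hB', hnt'⟩ := shift B g hB hnt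
      have hzB : z ∈ g⁻¹ • B := by rwa [Set.mem_inv_smul_set_iff, hgz]
      have hxB' := ih (by omega) a ha _ hB' hnt' z hzB x hz (by omega)
      rwa [Set.mem_inv_smul_set_iff, hgx] at hxB'
  have coord : ∀ k, k + 1 < n * q + 1 → k / q < n ∧ k = k / q * q + k % q ∧ k % q < q :=
    fun k hk => ⟨Nat.div_lt_of_lt_mul (by rw [mul_comm]; omega), (Nat.div_add_mod' k q).symm,
      Nat.mod_lt _ (by omega)⟩
  have : IsPretransitive H (Fin (n * q + 1)) := by
    rw [isPretransitive_iff_base (0 : Fin (n * q + 1))]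
    rintro ⟨k, hk⟩
    induction k with
    | zero => exact ⟨1, one_smul _ _⟩
    | succ k ih =>
      obtain ⟨g, hg⟩ := ih (by omega)
      obtain ⟨h1, h2, h3⟩ := coord k hk
      have hb := bound _ h1
      refine ⟨⟨stepCycle _ _ _ hb, hH _ hb h1⟩ * g, ?_⟩
      rw [mul_smul, hg]
      exact Fin.ext (stepCycle_apply_of_lt hb (by simp only; omega) (by simp only; omega))
  have hprim : IsPreprimitive H (Fin (n * q + 1)) := by
    refine .of_isTrivialBlock_base (0 : Fin (n * q + 1)) fun {B} h0 hB => ?_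
    refine B.subsingleton_or_nontrivial.imp id fun hnt => Set.eq_univ_of_forall ?_
    rintro ⟨k, hk⟩
    induction k with
    | zero => exact h0
    | succ k ih =>
      obtain ⟨h1, h2, h3⟩ := coord k hk
      exact next_mem _ h3 _ h1 B hB hnt _ (ih (by omega)) _ h2 rfl
  obtain ⟨t, htH, ht, -⟩ := threeCycle 0 (by omega)
  exact alternatingGroup_le_of_isPreprimitive_of_isThreeCycle_mem hprim ht htH

/-- For odd `p ≥ 3` and `n ≥ 2`, the overlapping step `p`-cycles starting at
`a * (p-1)` for `a = 0, …, n-1` generate the alternating group on `Fin (n*(p-1)+1)`. -/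
theorem closure_stepCycles_eq_alternatingGroup (p n : ℕ) (hodd : Odd p) (hp : 3 ≤ p)
    (hn : 2 ≤ n) :
    Subgroup.closure
      (Set.range fun a : Fin n =>
        stepCycle (n * (p - 1) + 1) (a.val * (p - 1)) p (stepCycle_bound (by omega) a)) =
      alternatingGroup (Fin (n * (p - 1) + 1)) := by
  apply le_antisymm
  · rw [Subgroup.closure_le]
    rintro _ ⟨a, rfl⟩
    exact stepCycle_mem_alternatingGroup _ hodd
  · obtain ⟨q, rfl⟩ : ∃ q, p = q + 1 := ⟨p - 1, by omega⟩
    exact alternatingGroup_le_of_stepCycle_mem (q := q) (by omega) hn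
      fun a _ han => Subgroup.subset_closure ⟨⟨a, han⟩, rfl⟩
end

section
/- Let B be a finite type with n = card B, let M be a Coxeter matrix on B such that M i j ≠ 1 whenever i ≠ j, and let cs be a Coxeter system with matrix M on a group W. Let G be a group, let S be a finite subset of G that generates G, and let f : G →* W be a surjective group homomorphism such that f(s) is a reflection of the Coxeter system cs for every s ∈ S. Then n ≤ |S|. -/
/-- The product of two linear reflections whose pairings multiply to `4 cos² (π / m)` has order
dividing `m`, for `m ≥ 3`. -/
theorem Module.reflection_mul_reflection_pow_eq_one {V : Type*} [AddCommGroup V] [Module ℝ V]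
    {x y : V} {f g : Module.Dual ℝ V} (hf : f x = 2) (hg : g y = 2) {m : ℕ} (hm : 3 ≤ m)
    (h : f y * g x = 4 * Real.cos (Real.pi / m) ^ 2) :
    (Module.reflection hf * Module.reflection hg) ^ m = 1 := by
  have hm0 : (0 : ℝ) < m := by positivity
  set θ : ℝ := 2 * Real.pi / m with hθ
  have hmθ : m * θ = 2 * Real.pi := by rw [hθ]; field_simp
  have ht : 2 * Real.cos θ = f y * g x - 2 := by
    rw [h, hθ, mul_div_assoc, Real.cos_two_mul]; ring
  have hsin : Real.sin θ ≠ 0 := by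
    refine (Real.sin_pos_of_pos_of_lt_pi (by positivity) ?_).ne'
    have : (3 : ℝ) ≤ m := by exact_mod_cast hm
    rw [hθ, div_lt_iff₀ hm0]
    nlinarith [Real.pi_pos]
  have hS := Polynomial.Chebyshev.S_two_mul_real_cos θ
  ext z
  rw [Module.reflection_mul_reflection_pow_apply hf hg m z _ ht, LinearEquiv.coe_one, id]
  obtain ⟨k, rfl | rfl⟩ := Nat.even_or_odd' m
  · have hzero : (Polynomial.Chebyshev.S ℝ (k - 1)).eval (2 * Real.cos θ) = 0 := by
      refine (mul_eq_zero.mp ?_).resolve_right hsin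
      push_cast at hmθ
      rw [hS, show (((k : ℤ) - 1 : ℤ) + 1 : ℝ) * θ = Real.pi by push_cast; linarith, Real.sin_pi]
    rw [show (((2 * k : ℕ) : ℤ) - 2) / 2 = k - 1 by lia,
      show (((2 * k : ℕ) : ℤ) - 1) / 2 = k - 1 by lia, hzero]
    simp
  · have hzero : (Polynomial.Chebyshev.S ℝ k).eval (2 * Real.cos θ) +
        (Polynomial.Chebyshev.S ℝ (k - 1)).eval (2 * Real.cos θ) = 0 := by
      refine (mul_eq_zero.mp ?_).resolve_right hsin
      push_cast at hmθ
      rw [add_mul, hS, hS, show (((k : ℤ) : ℝ) + 1) * θ = 2 * Real.pi - k * θ by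
        push_cast; linarith, Real.sin_two_pi_sub]
      push_cast
      ring_nf
    rw [show (((2 * k + 1 : ℕ) : ℤ) - 2) / 2 = k - 1 by lia,
      show (((2 * k + 1 : ℕ) : ℤ) - 1) / 2 = k by lia,
      show (((2 * k + 1 : ℕ) : ℤ) - 3) / 2 = k - 1 by lia,
      show ((2 * k + 1 : ℕ) : ℤ) / 2 = k by lia, hzero]
    simp

namespace CoxeterMatrix

variable {B : Type*} (M : CoxeterMatrix B)

/-- The linear form pairing the `j`-th basis vector with `-2 cos (π / M i j)`. -/
noncomputable def simpleCoroot (i : B) : Module.Dual ℝ (B →₀ ℝ) :=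
  Finsupp.linearCombination ℝ fun j ↦ -2 * Real.cos (Real.pi / M i j)

theorem simpleCoroot_single (i j : B) :
    M.simpleCoroot i (Finsupp.single j 1) = -2 * Real.cos (Real.pi / M i j) := by
  simp [simpleCoroot]

theorem simpleCoroot_single_self (i : B) : M.simpleCoroot i (Finsupp.single i 1) = 2 := by
  simp [simpleCoroot_single]

theorem isLiftable_reflection (hM : ∀ i j : B, i ≠ j → M i j ≠ 1) :
    M.IsLiftable fun i ↦ Module.reflection (M.simpleCoroot_single_self i) := by
  intro i j
  obtain rfl | hij := eq_or_ne i j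
  · ext1 z
    simpa using Module.involutive_reflection (M.simpleCoroot_single_self i) z
  have h1 := hM i j hij
  obtain h | h | h : M i j = 0 ∨ M i j = 2 ∨ 3 ≤ M i j := by lia
  · rw [h, pow_zero]
  · have hi : M.simpleCoroot i (Finsupp.single j 1) = 0 := by simp [simpleCoroot_single, h]
    have hj : M.simpleCoroot j (Finsupp.single i 1) = 0 := by
      simp [simpleCoroot_single, M.symmetric j i, h]
    ext1 z
    simp only [h, pow_two, LinearEquiv.mul_apply, Module.reflection_apply, map_sub, map_smul, hi,
      hj, simpleCoroot_single_self, LinearEquiv.coe_one, id]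
    module
  · refine Module.reflection_mul_reflection_pow_eq_one _ _ h ?_
    rw [simpleCoroot_single, simpleCoroot_single, M.symmetric j i]
    ring

end CoxeterMatrix

namespace CoxeterSystem

variable {B W : Type*} [Group W] {M : CoxeterMatrix B} (cs : CoxeterSystem M W)

/-- The geometric representation of a Coxeter group. -/
noncomputable def geometricRep (hM : ∀ i j : B, i ≠ j → M i j ≠ 1) :
    W →* ((B →₀ ℝ) ≃ₗ[ℝ] (B →₀ ℝ)) :=
  cs.lift ⟨_, M.isLiftable_reflection hM⟩

theorem geometricRep_simple (hM : ∀ i j : B, i ≠ j → M i j ≠ 1) (i : B) :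
    cs.geometricRep hM (cs.simple i) = Module.reflection (M.simpleCoroot_single_self i) :=
  cs.lift_apply_simple _ i

theorem IsReflection.exists_geometricRep_sub_mem_span {cs : CoxeterSystem M W} {t : W}
    (ht : cs.IsReflection t) (hM : ∀ i j : B, i ≠ j → M i j ≠ 1) :
    ∃ v : B →₀ ℝ, ∀ x, cs.geometricRep hM t x - x ∈ Submodule.span ℝ {v} := by
  obtain ⟨w, i, rfl⟩ := ht
  refine ⟨cs.geometricRep hM w (Finsupp.single i 1), fun x ↦ ?_⟩
  have hx : cs.geometricRep hM w (cs.geometricRep hM w⁻¹ x) = x := by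
    rw [← LinearEquiv.mul_apply, ← map_mul, mul_inv_cancel, map_one, LinearEquiv.coe_one, id]
  rw [map_mul, map_mul, LinearEquiv.mul_apply, LinearEquiv.mul_apply, geometricRep_simple,
    Module.reflection_apply, map_sub, map_smul, hx, sub_sub_cancel_left]
  exact neg_mem (Submodule.smul_mem _ _ (Submodule.mem_span_singleton_self _))

end CoxeterSystem

/-- If every generator of a group acts trivially on a quotient module, so does the whole group. -/
theorem sub_mem_of_closure_eq_top {R V G : Type*} [Ring R] [AddCommGroup V] [Module R V] [Group G]
    (ρ : G →* (V ≃ₗ[R] V)) {S : Set G} (hS : Subgroup.closure S = ⊤) {U : Submodule R V}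
    (h : ∀ s ∈ S, ∀ x, ρ s x - x ∈ U) (g : G) (x : V) : ρ g x - x ∈ U := by
  have hg : g ∈ Subgroup.closure S := hS ▸ Subgroup.mem_top g
  induction hg using Subgroup.closure_induction generalizing x with
  | mem s hs => exact h s hs x
  | one => simp
  | mul a b _ _ ha hb =>
    rw [map_mul, LinearEquiv.mul_apply, ← sub_add_sub_cancel _ (ρ b x)]
    exact add_mem (ha _) (hb x)
  | inv a _ ha =>
    have hx : ρ a (ρ a⁻¹ x) = x := by
      rw [← LinearEquiv.mul_apply, ← map_mul, mul_inv_cancel, map_one, LinearEquiv.coe_one, id]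
    have := ha (ρ a⁻¹ x)
    rwa [hx, ← neg_mem_iff, neg_sub] at this

/-- If a group `G` is generated by a finite set `S` and there is a surjective
homomorphism `f : G →* W` onto a Coxeter group with Coxeter system `cs` on a finite type `B`
(where the Coxeter matrix satisfies `M i j ≠ 1` for `i ≠ j`, which is part of the definition of
`CoxeterMatrix`), sending every element of `S` to a reflection, then `card B ≤ |S|`. -/
theorem card_le_of_surjective_onto_coxeter {B : Type*} [Fintype B] {W : Type*} [Group W]
    (M : CoxeterMatrix B) (hM : ∀ i j : B, i ≠ j → M i j ≠ 1)
    (cs : CoxeterSystem M W)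
    {G : Type*} [Group G] (S : Finset G)
    (hS : Subgroup.closure (S : Set G) = ⊤)
    (f : G →* W) (hf : Function.Surjective f)
    (hrefl : ∀ s ∈ S, cs.IsReflection (f s)) :
    Fintype.card B ≤ S.card := by
  classical
  choose! v hv using fun s hs ↦ (hrefl s hs).exists_geometricRep_sub_mem_span hM
  set U : Submodule ℝ (B →₀ ℝ) := Submodule.span ℝ (S.image v : Finset (B →₀ ℝ)) with hU
  have hmem : ∀ g x, (cs.geometricRep hM).comp f g x - x ∈ U :=
    sub_mem_of_closure_eq_top _ hS fun s hs x ↦ Submodule.span_mono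
      (Set.singleton_subset_iff.mpr (Finset.mem_image_of_mem v hs)) (hv s hs x)
  have htop : U = ⊤ := by
    rw [eq_top_iff, ← (Finsupp.basisSingleOne (R := ℝ) (ι := B)).span_eq, Submodule.span_le]
    rintro _ ⟨i, rfl⟩
    obtain ⟨g, hg⟩ := hf (cs.simple i)
    have h := hmem g (Finsupp.single i 1)
    rw [MonoidHom.comp_apply, hg, cs.geometricRep_simple, Module.reflection_apply_self,
      show -Finsupp.single i (1 : ℝ) - Finsupp.single i 1 = (-2 : ℝ) • Finsupp.single i 1 by
        module, U.smul_mem_iff (by norm_num)] at h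
    simpa using h
  calc Fintype.card B = Module.finrank ℝ U := by
        rw [htop, finrank_top, Module.finrank_finsupp_self]
    _ ≤ (S.image v).card := finrank_span_finset_le_card _
    _ ≤ S.card := Finset.card_image_le
end

section
/- Let G be a group, let n ≥ 1, let m_1, …, m_n be positive integers that are pairwise coprime, and let x_1, y_1, …, x_n, y_n be elements of G such that: (i) the set {x_1, y_1, …, x_n, y_n} generates G; (ii) x_i^{m_i} = y_i^{m_i} for every i; (iii) x_i = x_{i+1} whenever 1 ≤ i < n and i is odd; (iv) y_i = y_{i+1} whenever 1 ≤ i < n and i is even. Then: if n is odd, the two elements y_1 and x_n generate G; and if n is even, the two elements y_1 and y_n generate G. -/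
/-- If consecutive terms of a sequence agree after raising to the powers `k j`, then the end terms
agree after raising to the product of these powers. -/
theorem pow_prod_Ico_eq_of_chain {G : Type*} [Monoid G] (z : ℕ → G) (k : ℕ → ℕ) {a b : ℕ}
    (hab : a ≤ b) (h : ∀ j, a ≤ j → j < b → z j ^ k j = z (j + 1) ^ k j) :
    z a ^ ∏ j ∈ Finset.Ico a b, k j = z b ^ ∏ j ∈ Finset.Ico a b, k j := by
  induction b, hab using Nat.le_induction with
  | base => rfl
  | succ b hab ih =>
    rw [Finset.prod_Ico_succ_top hab, pow_mul, ih fun j hj hjb => h j hj (by omega),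
      pow_mul', pow_right_comm,
      h b hab (Nat.lt_succ_self b)]

/-- A subgroup containing two powers of `g` with coprime exponents contains `g`. -/
theorem Subgroup.mem_of_pow_mem_of_coprime {G : Type*} [Group G] (H : Subgroup G) {g : G}
    {a b : ℕ} (hab : Nat.Coprime a b) (ha : g ^ a ∈ H) (hb : g ^ b ∈ H) : g ∈ H := by
  have hg : g = (g ^ a) ^ a.gcdA b * (g ^ b) ^ a.gcdB b := by
    rw [← zpow_natCast g a, ← zpow_natCast g b, ← zpow_mul, ← zpow_mul, ← zpow_add,
      ← Nat.gcd_eq_gcd_ab, hab.gcd_eq_one, Nat.cast_one, zpow_one]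
  rw [hg]
  exact H.mul_mem (H.zpow_mem ha _) (H.zpow_mem hb _)

/-- If consecutive terms of `z 0, …, z n` agree after raising to pairwise coprime powers, then every
term lies in any subgroup containing both end terms. -/
theorem Subgroup.mem_of_coprime_chain {G : Type*} [Group G] (H : Subgroup G) (z : ℕ → G)
    (k : ℕ → ℕ) {n : ℕ} (h : ∀ j, j < n → z j ^ k j = z (j + 1) ^ k j)
    (hcop : ∀ i j, i < j → j < n → Nat.Coprime (k i) (k j))
    (h0 : z 0 ∈ H) (hn : z n ∈ H) {i : ℕ} (hi : i ≤ n) : z i ∈ H := by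
  refine H.mem_of_pow_mem_of_coprime (a := ∏ j ∈ Finset.Ico 0 i, k j)
    (b := ∏ j ∈ Finset.Ico i n, k j) ?_ ?_ ?_
  · refine Nat.Coprime.prod_left fun p hp => Nat.Coprime.prod_right fun q hq => ?_
    rw [Finset.mem_Ico] at hp hq
    exact hcop p q (by omega) hq.2
  · rw [← pow_prod_Ico_eq_of_chain z k (Nat.zero_le i) fun j _ hj => h j (by omega)]
    exact H.pow_mem h0 _
  · rw [pow_prod_Ico_eq_of_chain z k hi fun j _ hj => h j hj]
    exact H.pow_mem hn _


/-- Let `G` be generated by `x_1, y_1, …, x_n, y_n` with `x_i^{m_i} = y_i^{m_i}`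
for pairwise coprime positive `m_i`, where `x_i = x_{i+1}` for odd `i < n` and `y_i = y_{i+1}`
for even `i < n`. Then if `n` is odd, `y_1` and `x_n` generate `G`; if `n` is even, `y_1` and
`y_n` generate `G`. -/
theorem two_meridians_generate_connected_sum {G : Type*} [Group G] (n : ℕ) (hn : 1 ≤ n)
    (m : ℕ → ℕ) (hm : ∀ i, 1 ≤ i → i ≤ n → 0 < m i)
    (hcop : ∀ i j, 1 ≤ i → i ≤ n → 1 ≤ j → j ≤ n → i ≠ j → Nat.Coprime (m i) (m j))
    (x y : ℕ → G)
    (hgen : Subgroup.closure {g | ∃ i, 1 ≤ i ∧ i ≤ n ∧ (g = x i ∨ g = y i)} = ⊤)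
    (hxy : ∀ i, 1 ≤ i → i ≤ n → (x i) ^ (m i) = (y i) ^ (m i))
    (hodd : ∀ i, 1 ≤ i → i < n → Odd i → x i = x (i + 1))
    (heven : ∀ i, 1 ≤ i → i < n → Even i → y i = y (i + 1)) :
    (Odd n → Subgroup.closure {y 1, x n} = ⊤) ∧
    (Even n → Subgroup.closure {y 1, y n} = ⊤) := by
  let z : ℕ → G := fun i => if i = 0 then y 1 else if Odd i then x i else y i
  have z_odd : ∀ j, j < n → Odd (j + 1) → z j = y (j + 1) ∧ z (j + 1) = x (j + 1) := by
    intro j hj hodd_succ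
    refine ⟨?_, by simp [z, hodd_succ]⟩
    rcases Nat.eq_zero_or_pos j with rfl | hpos
    · simp [z]
    · have hj_even : Even j := by grind
      simp [z, hpos.ne', Nat.not_odd_iff_even.mpr hj_even, heven j hpos hj hj_even]
  have z_even : ∀ j, j < n → Even (j + 1) → z j = x (j + 1) ∧ z (j + 1) = y (j + 1) := by
    intro j hj heven_succ
    have hj_odd : Odd j := by grind
    exact ⟨by simp [z, hj_odd.pos.ne', hj_odd, hodd j hj_odd.pos hj hj_odd],
      by simp [z, Nat.not_odd_iff_even.mpr heven_succ]⟩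
  have closure_eq_top : Subgroup.closure {y 1, z n} = ⊤ := by
    rw [eq_top_iff, ← hgen, Subgroup.closure_le]
    have z_mem : ∀ i, i ≤ n → z i ∈ Subgroup.closure {y 1, z n} := by
      intro i hi
      refine Subgroup.mem_of_coprime_chain _ z (fun j => m (j + 1)) (n := n) ?_ ?_ ?_ ?_ hi
      · intro j hj
        have hpow := hxy (j + 1) (by omega) hj
        rcases Nat.even_or_odd (j + 1) with hp | hp
        · rw [(z_even j hj hp).1, (z_even j hj hp).2, hpow]
        · rw [(z_odd j hj hp).1, (z_odd j hj hp).2, hpow]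
      · intro p q hpq hq
        exact hcop _ _ (by omega) (by omega) (by omega) (by omega) (by omega)
      · exact Subgroup.subset_closure (by simp [z])
      · exact Subgroup.subset_closure (by simp)
    rintro g ⟨i, hi, hin, hg⟩
    obtain ⟨j, rfl⟩ := Nat.exists_eq_add_of_le' hi
    have hj := z_mem j (by omega)
    have hj_succ := z_mem (j + 1) hin
    rcases Nat.even_or_odd (j + 1) with hp | hp
    · rw [(z_even j hin hp).1] at hj
      rw [(z_even j hin hp).2] at hj_succ
      rcases hg with rfl | rfl <;> assumption
    · rw [(z_odd j hin hp).1] at hj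
      rw [(z_odd j hin hp).2] at hj_succ
      rcases hg with rfl | rfl <;> assumption
  have hn0 : n ≠ 0 := by omega
  constructor
  · intro h
    simpa [z, hn0, h] using closure_eq_top
  · intro h
    simpa [z, hn0, Nat.not_odd_iff_even.mpr h] using closure_eq_top
end

section
/- Let G be a group, let φ : G →* Multiplicative ℤ be a group homomorphism, let x ∈ G satisfy φ(x) = Multiplicative.ofAdd 1, let k be a natural number, and let c : Fin k → G be such that c i ∈ ker φ for every i. Suppose that the set {x} ∪ range c generates G. Then ker φ equals the subgroup of G generated by the set { x^j * (c i) * x^{−j} : j ∈ ℤ, i ∈ Fin k }. -/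
section ConjugateClosure

variable {G ι : Type*} [Group G] {x : G} {c : ι → G}

/-- The subgroup generated by the conjugates of the `c i` by powers of `x` is stable under
conjugation by powers of `x`. -/
theorem zpow_conj_mem_closure_conjugates (a : ℤ) {m : G}
    (hm : m ∈ Subgroup.closure {g | ∃ (j : ℤ) (i : ι), g = x ^ j * c i * x ^ (-j)}) :
    x ^ a * m * x ^ (-a) ∈
      Subgroup.closure {g | ∃ (j : ℤ) (i : ι), g = x ^ j * c i * x ^ (-j)} := by
  induction hm using Subgroup.closure_induction with
  | mem g hg =>
    obtain ⟨j, i, rfl⟩ := hg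
    refine Subgroup.subset_closure ⟨a + j, i, ?_⟩
    rw [neg_add_rev, zpow_add, zpow_add]
    simp only [mul_assoc]
  | one => simp
  | mul g h _ _ hg hh =>
    convert mul_mem hg hh using 1
    group
  | inv g _ hg =>
    convert inv_mem hg using 1
    group

/-- If `x` and the `c i` generate `G`, every element of `G` is a product of an element of the
subgroup generated by the conjugates of the `c i` by powers of `x` and a power of `x`. -/
theorem exists_mem_closure_conjugates_mul_zpow
    (hgen : Subgroup.closure ({x} ∪ Set.range c) = ⊤) (g : G) :
    ∃ n ∈ Subgroup.closure {g | ∃ (j : ℤ) (i : ι), g = x ^ j * c i * x ^ (-j)},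
      ∃ a : ℤ, g = n * x ^ a := by
  have hg : g ∈ Subgroup.closure ({x} ∪ Set.range c) := hgen ▸ Subgroup.mem_top g
  induction hg using Subgroup.closure_induction with
  | mem g hg =>
    rcases hg with rfl | ⟨i, rfl⟩
    · exact ⟨1, one_mem _, 1, by simp⟩
    · exact ⟨c i, Subgroup.subset_closure ⟨0, i, by simp⟩, 0, by simp⟩
  | one => exact ⟨1, one_mem _, 0, by simp⟩
  | mul g h _ _ hg hh =>
    obtain ⟨n, hn, a, rfl⟩ := hg
    obtain ⟨m, hm, b, rfl⟩ := hh
    exact ⟨_, mul_mem hn (zpow_conj_mem_closure_conjugates a hm), a + b, by group⟩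
  | inv g _ hg =>
    obtain ⟨n, hn, a, rfl⟩ := hg
    exact ⟨_, zpow_conj_mem_closure_conjugates (-a) (inv_mem hn), -a, by group⟩

end ConjugateClosure


/-- If `φ : G →* Multiplicative ℤ` sends `x` to the generator, each `c i` lies in
`ker φ`, and `{x} ∪ range c` generates `G`, then `ker φ` is generated by all conjugates
`x^j * c i * x^{-j}` for `j : ℤ`, `i : Fin k`. -/
theorem ker_eq_closure_conjugates {G : Type*} [Group G]
    (φ : G →* Multiplicative ℤ) (x : G) (hx : φ x = Multiplicative.ofAdd 1)
    (k : ℕ) (c : Fin k → G) (hc : ∀ i, c i ∈ φ.ker)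
    (hgen : Subgroup.closure ({x} ∪ Set.range c) = ⊤) :
    φ.ker = Subgroup.closure {g | ∃ (j : ℤ) (i : Fin k), g = x ^ j * c i * x ^ (-j)} := by
  have hle : Subgroup.closure {g | ∃ (j : ℤ) (i : Fin k), g = x ^ j * c i * x ^ (-j)} ≤
      φ.ker := by
    rw [Subgroup.closure_le]
    rintro _ ⟨j, i, rfl⟩
    rw [zpow_neg]
    exact φ.normal_ker.conj_mem _ (hc i) _
  refine le_antisymm (fun g hg => ?_) hle
  obtain ⟨n, hn, a, rfl⟩ := exists_mem_closure_conjugates_mul_zpow hgen g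
  have ha : a = 0 := by
    rw [MonoidHom.mem_ker, map_mul, MonoidHom.mem_ker.mp (hle hn), one_mul, map_zpow, hx,
      ← ofAdd_zsmul, ofAdd_eq_one] at hg
    simpa using hg
  simpa [ha] using hn
end

section
/- Let G be a group, let φ : G →* Multiplicative ℤ be a group homomorphism, let x ∈ G satisfy φ(x) = Multiplicative.ofAdd 1, let k be a natural number, and let c : Fin k → G be such that c i ∈ ker φ for every i. Suppose that the set {x} ∪ range c generates G, and suppose additionally that M ≥ 1 is a natural number with x^M in the center of G. Then ker φ equals the subgroup of G generated by the finite set { x^j * (c i) * x^{−j} : 0 ≤ j ≤ M−1, i ∈ Fin k }; in particular, ker φ is generated by at most M·k elements. -/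
/-- The kernel of a homomorphism to the infinite cyclic group sending `x` to the generator is
contained in any normal subgroup that together with `x` generates the group. -/
theorem MonoidHom.ker_le_of_closure_singleton_union_eq_top {G : Type*} [Group G]
    (φ : G →* Multiplicative ℤ) {x : G} (hx : φ x = Multiplicative.ofAdd 1)
    {A : Set G} (hgen : Subgroup.closure ({x} ∪ A) = ⊤)
    (N : Subgroup G) [N.Normal] (hA : A ⊆ N) (hN : N ≤ φ.ker) : φ.ker ≤ N := by
  have htop : N ⊔ Subgroup.zpowers x = ⊤ := by
    rw [eq_top_iff, ← hgen, Subgroup.closure_le]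
    rintro g (rfl | hg)
    · exact Subgroup.mem_sup_right (Subgroup.mem_zpowers g)
    · exact Subgroup.mem_sup_left (hA hg)
  intro g hg
  obtain ⟨h, hh, y, ⟨n, rfl⟩, rfl⟩ :=
    Subgroup.mem_sup_of_normal_left.mp (htop ▸ Subgroup.mem_top g)
  have hφ : φ h = 1 := hN hh
  have hn : n = 0 := by
    have : (Multiplicative.ofAdd (1 : ℤ)) ^ n = 1 := by
      simpa [MonoidHom.mem_ker, hφ, hx] using hg
    simpa [← ofAdd_zsmul] using this
  simpa [hn] using hh

/-- If a positive power `x ^ M` is central, every conjugate of `a` by an integer power of `x`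
is a conjugate by one of `1, x, …, x ^ (M - 1)`. -/
theorem exists_conj_pow_eq_conj_zpow {G : Type*} [Group G] {x : G} {M : ℕ} (hM : 1 ≤ M)
    (hcen : x ^ M ∈ Subgroup.center G) (n : ℤ) (a : G) :
    ∃ j : ℕ, j ≤ M - 1 ∧ x ^ n * a * (x ^ n)⁻¹ = x ^ j * a * (x ^ j)⁻¹ := by
  have hpos : (0 : ℤ) < M := by exact_mod_cast hM
  have h0 := Int.emod_nonneg n hpos.ne'
  have h1 := Int.emod_lt_of_pos n hpos
  refine ⟨(n % M).toNat, by omega, ?_⟩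
  have hz : (x ^ M) ^ (n / M) ∈ Subgroup.center G := Subgroup.zpow_mem _ hcen _
  have hn : x ^ n = x ^ (n % M).toNat * (x ^ M) ^ (n / M) := by
    rw [← zpow_natCast x (n % M).toNat, Int.toNat_of_nonneg h0, ← zpow_natCast x M, ← zpow_mul,
      ← zpow_add, Int.emod_add_mul_ediv]
  have hcomm := Subgroup.mem_center_iff.mp hz a
  rw [hn, mul_assoc (x ^ (n % M).toNat), ← hcomm]
  group

/-- A subgroup generated by a set stable under conjugation by all integer powers of `x`
is normalized by `x`. -/
theorem Subgroup.mem_normalizer_closure_of_conj_zpow_mem {G : Type*} [Group G] {x : G} {S : Set G}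
    (hS : ∀ n : ℤ, ∀ s ∈ S, x ^ n * s * (x ^ n)⁻¹ ∈ S) :
    x ∈ Subgroup.normalizer (Subgroup.closure S : Set G) := by
  have key (n : ℤ) {h : G} (hh : h ∈ closure S) : x ^ n * h * (x ^ n)⁻¹ ∈ closure S := by
    have hle : closure S ≤ (closure S).comap (MulAut.conj (x ^ n)).toMonoidHom :=
      (closure_le _).mpr fun s hs => subset_closure (hS n s hs)
    exact hle hh
  refine Subgroup.mem_normalizer_iff.mpr fun h => ⟨fun hh => ?_, fun hh => ?_⟩
  · simpa using key 1 hh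
  · simpa [mul_assoc] using key (-1) hh


/-- If `φ : G →* Multiplicative ℤ` sends `x` to the generator, each `c i` lies in
`ker φ`, `{x} ∪ range c` generates `G`, and `x^M` is central for some `M ≥ 1`, then `ker φ` is
generated by the finite set of conjugates `x^j * c i * x^{-j}` for `0 ≤ j ≤ M-1`, `i : Fin k`;
in particular `ker φ` is generated by at most `M * k` elements. -/
theorem ker_eq_closure_finitely_many_conjugates {G : Type*} [Group G]
    (φ : G →* Multiplicative ℤ) (x : G) (hx : φ x = Multiplicative.ofAdd 1)
    (k : ℕ) (c : Fin k → G) (hc : ∀ i, c i ∈ φ.ker)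
    (hgen : Subgroup.closure ({x} ∪ Set.range c) = ⊤)
    (M : ℕ) (hM : 1 ≤ M) (hcen : x ^ M ∈ Subgroup.center G) :
    φ.ker = Subgroup.closure
        {g | ∃ (j : ℕ) (i : Fin k), j ≤ M - 1 ∧ g = x ^ j * c i * (x ^ j)⁻¹} ∧
    ∃ T : Finset G, T.card ≤ M * k ∧ Subgroup.closure (T : Set G) = φ.ker := by
  set S : Set G := {g | ∃ (j : ℕ) (i : Fin k), j ≤ M - 1 ∧ g = x ^ j * c i * (x ^ j)⁻¹} with hS
  have hcS : Set.range c ⊆ Subgroup.closure S := by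
    rintro _ ⟨i, rfl⟩
    exact Subgroup.subset_closure ⟨0, i, Nat.zero_le _, by simp⟩
  have hconj : ∀ n : ℤ, ∀ s ∈ S, x ^ n * s * (x ^ n)⁻¹ ∈ S := by
    rintro n _ ⟨j, i, -, rfl⟩
    obtain ⟨l, hl, h⟩ := exists_conj_pow_eq_conj_zpow hM hcen (n + j) (c i)
    refine ⟨l, i, hl, ?_⟩
    rw [← h, zpow_add, zpow_natCast]
    group
  have hnormal : (Subgroup.closure S).Normal := by
    rw [← Subgroup.normalizer_eq_top_iff, eq_top_iff, ← hgen, Subgroup.closure_le]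
    rintro g (rfl | hg)
    · exact Subgroup.mem_normalizer_closure_of_conj_zpow_mem hconj
    · exact Subgroup.le_normalizer (hcS hg)
  have hle : Subgroup.closure S ≤ φ.ker := by
    rw [Subgroup.closure_le]
    rintro _ ⟨j, i, -, rfl⟩
    exact φ.normal_ker.conj_mem _ (hc i) _
  have hker : φ.ker = Subgroup.closure S :=
    le_antisymm (φ.ker_le_of_closure_singleton_union_eq_top hx hgen _ hcS hle) hle
  refine ⟨hker, ?_⟩
  classical
  refine ⟨(Finset.range M ×ˢ Finset.univ).image fun p : ℕ × Fin k =>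
    x ^ p.1 * c p.2 * (x ^ p.1)⁻¹, ?_, ?_⟩
  · exact Finset.card_image_le.trans (by simp)
  · rw [hker]
    congr 1
    ext g
    simp only [Finset.coe_image, Set.mem_image, Finset.mem_coe, Finset.mem_product,
      Finset.mem_range, Finset.mem_univ, and_true, Prod.exists, hS, Set.mem_ofPred_eq,
      Nat.le_sub_one_iff_lt hM]
    exact exists₂_congr fun j i => and_congr_right fun _ => eq_comm
end

section
/- For every natural number m ≥ 2, the ideal of the Laurent polynomial ring ℤ[t, t^{−1}] (LaurentPolynomial ℤ) generated by the two elements 2 and 1 + t + t² + ⋯ + t^{m−1} is a proper ideal, i.e., it is not the whole ring. -/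
open Polynomial in
/-- Over an algebraically closed field, `1 + x + ⋯ + x^{m-1}` has a nonzero root for `m ≥ 2`. -/
theorem IsAlgClosed.exists_unit_geom_sum_eq_zero (K : Type*) [Field K] [IsAlgClosed K]
    {m : ℕ} (hm : 2 ≤ m) : ∃ u : Kˣ, ∑ i ∈ Finset.range m, (u : K) ^ i = 0 := by
  have hcoeff : (∑ i ∈ Finset.range m, (X : K[X]) ^ i).coeff 1 = 1 := by
    simp [finsetSum_coeff, coeff_X_pow]
    omega
  have hdeg : (∑ i ∈ Finset.range m, (X : K[X]) ^ i).degree ≠ 0 := by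
    intro h
    rw [eq_C_of_degree_eq_zero h, coeff_C_succ] at hcoeff
    exact zero_ne_one hcoeff
  obtain ⟨x, hx⟩ := IsAlgClosed.exists_root _ hdeg
  have hsum : ∑ i ∈ Finset.range m, x ^ i = 0 := by
    simpa [IsRoot.def, eval_finsetSum] using hx
  have hx0 : x ≠ 0 := by
    rintro rfl
    rw [zero_geom_sum, if_neg (by omega)] at hsum
    exact one_ne_zero hsum
  exact ⟨Units.mk0 x hx0, hsum⟩

/-- For `m ≥ 2`, the ideal of `ℤ[t, t⁻¹]` generated by `2` and
`1 + t + t² + ⋯ + t^{m-1}` is a proper ideal. -/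
theorem span_two_cyclotomicish_ne_top (m : ℕ) (hm : 2 ≤ m) :
    Ideal.span {(2 : LaurentPolynomial ℤ),
        ∑ i ∈ Finset.range m, LaurentPolynomial.T (i : ℤ)} ≠ ⊤ := by
  let K := AlgebraicClosure (ZMod 2)
  obtain ⟨u, hu⟩ := IsAlgClosed.exists_unit_geom_sum_eq_zero K hm
  let φ : LaurentPolynomial ℤ →+* K := LaurentPolynomial.eval₂ (Int.castRingHom K) u
  refine ne_top_of_le_ne_top (RingHom.ker_ne_top φ) (Ideal.span_le.2 ?_)
  rintro p (rfl | rfl)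
  · have : CharP K 2 := inferInstanceAs (CharP (AlgebraicClosure (ZMod 2)) 2)
    exact (map_ofNat φ 2).trans CharTwo.two_eq_zero
  · simpa only [SetLike.mem_coe, RingHom.mem_ker, map_sum, φ, LaurentPolynomial.eval₂_T_n]
      using hu
end
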